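/- arXiv:1402.5589 — 2 statements merged into one kernel-verified Lean document; each statement's English description precedes it below -/
import Mathlib

section
/- Let k ≥ 1 be an integer, 0 < α ≤ 1, p = (1 + α)k, and R > 0. Let B(0,R) = {x ∈ ℝ^k : |x| ≤ R} and let f : B(0,R) → ℝ be locally Lipschitz. Let x, y ∈ B(0,R) satisfy |x − y| = 2R. Then |f(x) − f(y)| ≤ 4 · ((1+α)/α) · k^{1/(2(1+α))} · R^{1 − k/p} · (∫_{B(0,R)} |∇f(z)|^p dz)^{1/p}. -/
open Real MeasureTheory Metric
noncomputable section

open scoped NNReal ENNReal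

lemma mi_line {k : ℕ} {g : EuclideanSpace ℝ (Fin k) → ℝ} {C : ℝ≥0} (hg : LipschitzWith C g)
    (x z : EuclideanSpace ℝ (Fin k))
    (hd : ∀ᵐ t ∂(volume.restrict (Set.Ioc (0:ℝ) 1)), DifferentiableAt ℝ g (x + t • (z - x))) :
    ‖g z - g x‖ₑ ≤ ∫⁻ t in Set.Ioc (0:ℝ) 1, ‖fderiv ℝ g (x + t • (z - x))‖ₑ * ‖z - x‖ₑ := by
  have hl : LipschitzWith (C * ‖z - x‖₊) (fun t : ℝ => g (x + t • (z - x))) := by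
    apply hg.comp
    apply LipschitzWith.of_dist_le_mul
    intro a b
    rw [dist_add_left, dist_eq_norm, ← sub_smul, norm_smul, dist_eq_norm, mul_comm]
    rfl
  have hac := (hl.lipschitzOnWith (s := Set.uIcc 0 1)).absolutelyContinuousOnInterval
  have h1 := hac.integral_deriv_eq_sub
  simp only [one_smul, add_sub_cancel, zero_smul, add_zero] at h1
  rw [← h1, intervalIntegral.integral_of_le zero_le_one]
  refine (enorm_integral_le_lintegral_enorm _).trans ?_
  apply lintegral_mono_ae
  filter_upwards [hd] with t ht
  have hline : HasDerivAt (fun t : ℝ => x + t • (z - x)) (z - x) t := by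
    simpa using ((hasDerivAt_id t).smul_const (z - x)).const_add x
  have h2 := ht.hasFDerivAt.comp_hasDerivAt t hline
  have h3 : deriv (fun t : ℝ => g (x + t • (z - x))) t = fderiv ℝ g (x + t • (z - x)) (z - x) :=
    h2.deriv
  rw [h3]
  exact ContinuousLinearMap.le_opENorm _ _

lemma mi_map {k : ℕ} (x : EuclideanSpace ℝ (Fin k)) {t : ℝ} (ht : 0 < t) :
    Measure.map (fun z => x + t • (z - x)) (volume : Measure (EuclideanSpace ℝ (Fin k)))
      = ENNReal.ofReal ((t ^ k)⁻¹) • volume := by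
  have h0 : (fun z : EuclideanSpace ℝ (Fin k) => x + t • (z - x))
      = (fun z => (x - t • x) + z) ∘ (fun z => t • z) := by
    funext z; simp only [Function.comp, smul_sub]; abel
  rw [h0, ← Measure.map_map (by fun_prop) (by fun_prop), Measure.map_addHaar_smul _ ht.ne',
    Measure.map_smul, map_add_left_eq_self]
  simp [abs_of_pos ht]

lemma mi_scale {k : ℕ} (x : EuclideanSpace ℝ (Fin k)) {R : ℝ} (hx : x ∈ closedBall 0 R)
    {t : ℝ} (ht : 0 < t) (ht1 : t ≤ 1) {h : EuclideanSpace ℝ (Fin k) → ℝ≥0∞} (hh : Measurable h) :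
    ∫⁻ z in closedBall 0 R, h (x + t • (z - x))
      ≤ ENNReal.ofReal ((t ^ k)⁻¹) * ∫⁻ z in closedBall 0 R, h z := by
  have hT : Measurable (fun z : EuclideanSpace ℝ (Fin k) => x + t • (z - x)) := by fun_prop
  rw [← lintegral_indicator measurableSet_closedBall, ← lintegral_indicator measurableSet_closedBall,
    ← smul_eq_mul, ← lintegral_smul_measure, ← mi_map x ht,
    lintegral_map (hh.indicator measurableSet_closedBall) hT]
  apply lintegral_mono
  intro z
  by_cases hz : z ∈ closedBall (0 : EuclideanSpace ℝ (Fin k)) R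
  · have : x + t • (z - x) ∈ closedBall (0 : EuclideanSpace ℝ (Fin k)) R :=
      (convex_closedBall _ _).add_smul_sub_mem hx hz ⟨ht.le, ht1⟩
    simp only [Set.indicator_of_mem hz, Set.indicator_of_mem this, le_refl]
  · simp only [Set.indicator_of_notMem hz, zero_le]

lemma mi_ae {k : ℕ} {g : EuclideanSpace ℝ (Fin k) → ℝ} {C : ℝ≥0} (hg : LipschitzWith C g)
    (x : EuclideanSpace ℝ (Fin k)) :
    ∀ᵐ z, ∀ᵐ t ∂(volume.restrict (Set.Ioc (0:ℝ) 1)), DifferentiableAt ℝ g (x + t • (z - x)) := by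
  have hm : MeasurableSet {q : EuclideanSpace ℝ (Fin k) × ℝ |
      DifferentiableAt ℝ g (x + q.2 • (q.1 - x))} := by
    have : Measurable (fun q : EuclideanSpace ℝ (Fin k) × ℝ => x + q.2 • (q.1 - x)) := by fun_prop
    exact this (measurableSet_of_differentiableAt ℝ g)
  rw [Measure.ae_ae_comm hm]
  filter_upwards [ae_restrict_mem measurableSet_Ioc] with t ht
  have h1 : ∀ᵐ w ∂(Measure.map (fun z => x + t • (z - x))
      (volume : Measure (EuclideanSpace ℝ (Fin k)))), DifferentiableAt ℝ g w := by
    rw [mi_map x ht.1]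
    exact Measure.ae_smul_measure hg.ae_differentiableAt _
  exact ae_of_ae_map (by fun_prop) h1

lemma mi_pow_int {s : ℝ} (hs : s < 1) :
    ∫⁻ t in Set.Ioc (0:ℝ) 1, ENNReal.ofReal (t ^ (-s)) = ENNReal.ofReal (1 / (1 - s)) := by
  have hi : IntervalIntegrable (fun t : ℝ => t ^ (-s)) volume 0 1 :=
    intervalIntegral.intervalIntegrable_rpow' (by linarith)
  rw [← ofReal_integral_eq_lintegral_ofReal, ← intervalIntegral.integral_of_le zero_le_one,
    integral_rpow (Or.inl (by linarith))]
  · rw [Real.one_rpow, Real.zero_rpow (by linarith)]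
    congr 1
    ring
  · rwa [intervalIntegrable_iff_integrableOn_Ioc_of_le zero_le_one] at hi
  · filter_upwards [ae_restrict_mem measurableSet_Ioc] with t ht
    exact Real.rpow_nonneg ht.1.le _

lemma mi_half {k : ℕ} {g : EuclideanSpace ℝ (Fin k) → ℝ} {C : ℝ≥0} (hg : LipschitzWith C g)
    (x : EuclideanSpace ℝ (Fin k)) {R : ℝ} (hx : x ∈ closedBall 0 R) {p : ℝ} (hp : 1 < p)
    (hkp : k < p) :
    ∫⁻ z in closedBall 0 R, ‖g z - g x‖ₑ ≤
      ENNReal.ofReal (2 * R) * (ENNReal.ofReal (1 / (1 - k / p)) *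
        ((∫⁻ z in closedBall 0 R, ‖fderiv ℝ g z‖ₑ ^ p) ^ (1 / p) *
        volume (closedBall (0 : EuclideanSpace ℝ (Fin k)) R) ^ (1 - 1 / p))) := by
  have hp0 : 0 < p := by linarith
  set B := closedBall (0 : EuclideanSpace ℝ (Fin k)) R
  set I := ∫⁻ z in B, ‖fderiv ℝ g z‖ₑ ^ p
  have hmf : Measurable (fun w => ‖fderiv ℝ g w‖ₑ) := (measurable_fderiv ℝ g).enorm
  have hmT : Measurable (fun q : EuclideanSpace ℝ (Fin k) × ℝ => x + q.2 • (q.1 - x)) := by fun_prop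
  calc ∫⁻ z in B, ‖g z - g x‖ₑ
      ≤ ∫⁻ z in B, ENNReal.ofReal (2 * R) * ∫⁻ t in Set.Ioc (0:ℝ) 1,
          ‖fderiv ℝ g (x + t • (z - x))‖ₑ := by
        apply lintegral_mono_ae
        filter_upwards [ae_restrict_of_ae (mi_ae hg x),
          ae_restrict_mem (measurableSet_closedBall)] with z hz hzB
        refine (mi_line hg x z hz).trans ?_
        rw [lintegral_mul_const' _ _ enorm_ne_top, mul_comm]
        gcongr
        rw [← ofReal_norm]
        apply ENNReal.ofReal_le_ofReal
        have h1 := norm_sub_le z x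
        have h2 : ‖z‖ ≤ R := by simpa [B] using hzB
        have h3 : ‖x‖ ≤ R := by simpa [B] using hx
        linarith
    _ = ENNReal.ofReal (2 * R) * ∫⁻ t in Set.Ioc (0:ℝ) 1, ∫⁻ z in B,
          ‖fderiv ℝ g (x + t • (z - x))‖ₑ := by
        rw [lintegral_const_mul' _ _ ENNReal.ofReal_ne_top, lintegral_lintegral_swap]
        exact (hmf.comp hmT).aemeasurable
    _ ≤ ENNReal.ofReal (2 * R) * ∫⁻ t in Set.Ioc (0:ℝ) 1, ENNReal.ofReal (t ^ (-(k/p))) *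
          (I ^ (1 / p) * volume B ^ (1 - 1 / p)) := by
        refine mul_le_mul_right ?_ _
        apply lintegral_mono_ae
        filter_upwards [ae_restrict_mem measurableSet_Ioc] with t ht
        have hq := Real.HolderConjugate.conjExponent hp
        have hT : Measurable (fun z : EuclideanSpace ℝ (Fin k) => x + t • (z - x)) := by fun_prop
        have hH := ENNReal.lintegral_mul_le_Lp_mul_Lq (volume.restrict B) hq
          (f := fun z => ‖fderiv ℝ g (x + t • (z - x))‖ₑ) (g := fun _ => 1)
          (hmf.comp hT).aemeasurable aemeasurable_const
        have hq' : 1 / p.conjExponent = 1 - 1 / p := by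
          have := hq.inv_add_inv_eq_one
          simp only [one_div]; linarith
        simp only [Pi.mul_apply, mul_one, ENNReal.one_rpow, lintegral_one,
          Measure.restrict_apply_univ, hq'] at hH
        refine hH.trans ?_
        rw [← mul_assoc]
        gcongr ?_ * _
        calc _ ≤ (ENNReal.ofReal ((t ^ k)⁻¹) * I) ^ (1 / p) := by
              gcongr
              exact mi_scale x hx ht.1 ht.2 (hmf.pow_const p)
          _ = _ := by
              rw [ENNReal.mul_rpow_of_nonneg _ _ (by positivity),
                ENNReal.ofReal_rpow_of_nonneg (by have := ht.1; positivity) (by positivity)]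
              congr 2
              rw [← Real.rpow_natCast, ← Real.rpow_neg ht.1.le, ← Real.rpow_mul ht.1.le]
              congr 1; ring
    _ = _ := by
        rw [lintegral_mul_const _ (by fun_prop), mi_pow_int]
        rw [div_lt_one hp0]; exact hkp

lemma mi_vol {k : ℕ} (hk : 1 ≤ k) {R : ℝ} (hR : 0 < R) :
    ENNReal.ofReal ((R / √k) ^ k) ≤ volume (closedBall (0 : EuclideanSpace ℝ (Fin k)) R) := by
  have hk0 : (0:ℝ) < k := by exact_mod_cast hk
  have hs : 0 < √(k:ℝ) := Real.sqrt_pos.2 hk0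
  have h1 : volume ((WithLp.ofLp : EuclideanSpace ℝ (Fin k) → _) ⁻¹'
      (Set.pi Set.univ fun _ => Set.Icc (0:ℝ) (R / √k))) = ENNReal.ofReal ((R / √k) ^ k) := by
    rw [(PiLp.volume_preserving_ofLp (Fin k)).measure_preimage
      (MeasurableSet.univ_pi fun _ => measurableSet_Icc).nullMeasurableSet, volume_pi_pi]
    simp [ENNReal.ofReal_pow (show 0 ≤ R / √k by positivity)]
  rw [← h1]
  apply measure_mono
  intro v hv
  simp only [Set.mem_preimage, Set.mem_pi, Set.mem_univ, forall_const, Set.mem_Icc] at hv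
  rw [mem_closedBall_zero_iff, EuclideanSpace.norm_eq]
  apply Real.sqrt_le_iff.2 ⟨hR.le, ?_⟩
  calc ∑ i, ‖v i‖ ^ 2 ≤ ∑ i : Fin k, (R / √k) ^ 2 := by
        apply Finset.sum_le_sum
        intro i _
        rw [Real.norm_eq_abs, sq_abs]
        have := hv i
        exact pow_le_pow_left₀ this.1 this.2 2
    _ = R ^ 2 := by
        simp only [Finset.sum_const, Finset.card_univ, Fintype.card_fin, nsmul_eq_mul, div_pow,
          Real.sq_sqrt hk0.le]
        field_simp

/-- **Lemma 2.5 (Morrey-type inequality).** Let `k ≥ 1`, `0 < α ≤ 1`, `p = (1+α)k`,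
`R > 0`. Let `f` be locally Lipschitz on the closed Euclidean ball `B(0,R) ⊆ ℝᵏ`, and let
`x, y ∈ B(0,R)` with `|x - y| = 2R`. Then
`|f(x) - f(y)| ≤ 4 * ((1+α)/α) * k^(1/(2(1+α))) * R^(1 - k/p) * (∫_{B(0,R)} |∇f|^p)^(1/p)`.
The (a.e.-defined) gradient of the locally Lipschitz `f` is encoded by `fderiv ℝ f`
(with the junk value `0` on the null set of non-differentiability points), whose operator
norm equals the Euclidean norm of the gradient. -/
theorem morrey_inequality_on_ball (k : ℕ) (hk : 1 ≤ k) (α R : ℝ)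
    (hα : 0 < α) (hα1 : α ≤ 1) (hR : 0 < R)
    (f : EuclideanSpace ℝ (Fin k) → ℝ)
    (hf : LocallyLipschitzOn (closedBall (0 : EuclideanSpace ℝ (Fin k)) R) f)
    (x y : EuclideanSpace ℝ (Fin k))
    (hx : x ∈ closedBall (0 : EuclideanSpace ℝ (Fin k)) R)
    (hy : y ∈ closedBall (0 : EuclideanSpace ℝ (Fin k)) R)
    (hxy : ‖x - y‖ = 2 * R) :
    |f x - f y| ≤ 4 * ((1 + α) / α) * (k : ℝ) ^ (1 / (2 * (1 + α))) *
        R ^ (1 - (k : ℝ) / ((1 + α) * k)) *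
        (∫ z in closedBall (0 : EuclideanSpace ℝ (Fin k)) R,
            ‖fderiv ℝ f z‖ ^ ((1 + α) * k)) ^ (1 / ((1 + α) * (k : ℝ))) := by
  have hk0 : (0:ℝ) < k := by exact_mod_cast hk
  have hk1 : (1:ℝ) ≤ k := by exact_mod_cast hk
  obtain ⟨C, hC⟩ := hf.exists_lipschitzOnWith_of_compact (isCompact_closedBall _ _)
  obtain ⟨g, hg, hfg⟩ := hC.extend_real
  rw [hfg hx, hfg hy]
  have hae : ∀ᵐ z ∂(volume.restrict (closedBall (0 : EuclideanSpace ℝ (Fin k)) R)),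
      fderiv ℝ f z = fderiv ℝ g z := by
    have hsph : ∀ᵐ z ∂(volume : Measure (EuclideanSpace ℝ (Fin k))), z ∉ sphere 0 R :=
      measure_eq_zero_iff_ae_notMem.1 (Measure.addHaar_sphere_of_ne_zero _ _ hR.ne')
    filter_upwards [ae_restrict_mem measurableSet_closedBall, ae_restrict_of_ae hsph] with z hz hz'
    have hzb : z ∈ ball (0 : EuclideanSpace ℝ (Fin k)) R := by
      rw [mem_ball]; exact lt_of_le_of_ne hz hz'
    apply Filter.EventuallyEq.fderiv_eq
    filter_upwards [isOpen_ball.mem_nhds hzb] with w hw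
    exact hfg (ball_subset_closedBall hw)
  rw [integral_congr_ae (g := fun z => ‖fderiv ℝ g z‖ ^ ((1 + α) * k))
    (by filter_upwards [hae] with z hz; rw [hz])]
  set p : ℝ := (1 + α) * k with hpdef
  have hp : 1 < p := by nlinarith
  have hkp : k < p := by nlinarith
  have hp0 : 0 < p := by linarith
  have hkps : (k : ℝ) / p = 1 / (1 + α) := by rw [hpdef]; field_simp
  have hcst : 1 / (1 - (k : ℝ) / p) = (1 + α) / α := by
    have : 1 - 1 / (1 + α) = α / (1 + α) := by field_simp; ring
    rw [hkps, this, one_div_div]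
  set B := closedBall (0 : EuclideanSpace ℝ (Fin k)) R with hB
  have hI : ∫⁻ z in B, ‖fderiv ℝ g z‖ₑ ^ p = ENNReal.ofReal (∫ z in B, ‖fderiv ℝ g z‖ ^ p) := by
    rw [ofReal_integral_eq_lintegral_ofReal]
    · apply lintegral_congr
      intro z
      rw [← ofReal_norm, ENNReal.ofReal_rpow_of_nonneg (norm_nonneg _) hp0.le]
    · apply Measure.integrableOn_of_bounded (M := (C : ℝ) ^ p)
      · exact measure_closedBall_lt_top.ne
      · exact ((measurable_fderiv ℝ g).norm.pow_const p).aestronglyMeasurable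
      · filter_upwards with z
        rw [Real.norm_of_nonneg (by positivity)]
        exact Real.rpow_le_rpow (norm_nonneg _) (norm_fderiv_le_of_lipschitz ℝ hg) hp0.le
    · filter_upwards with z
      positivity
  set I := ∫ z in B, ‖fderiv ℝ g z‖ ^ p
  have hI0 : 0 ≤ I := integral_nonneg fun z => by positivity
  set V := volume.real B
  have hVtop : volume B ≠ ⊤ := measure_closedBall_lt_top.ne
  have hV : volume B = ENNReal.ofReal V := (ENNReal.ofReal_toReal hVtop).symm
  have hVlow : (R / √k) ^ k ≤ V := by
    have := mi_vol hk hR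
    rw [← hB, hV] at this
    exact (ENNReal.ofReal_le_ofReal_iff measureReal_nonneg).1 this
  have hs : 0 < √(k:ℝ) := Real.sqrt_pos.2 hk0
  have hV0 : 0 < V := lt_of_lt_of_le (by positivity) hVlow
  have key : ENNReal.ofReal (|g x - g y| * V) ≤
      ENNReal.ofReal (2 * ((2 * R) * ((1 / (1 - k / p)) * (I ^ (1 / p) * V ^ (1 - 1 / p))))) := by
    have hhx := mi_half hg x hx hp hkp
    have hhy := mi_half hg y hy hp hkp
    have hc0 : 0 ≤ 1 / (1 - (k:ℝ) / p) := by rw [hcst]; positivity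
    have hp1 : 0 ≤ 1 - 1 / p := by
      rw [sub_nonneg, div_le_one hp0]; exact hp.le
    rw [← hB, hI, hV, ENNReal.ofReal_rpow_of_nonneg hI0 (by positivity),
      ENNReal.ofReal_rpow_of_nonneg hV0.le hp1, ← ENNReal.ofReal_mul (by positivity),
      ← ENNReal.ofReal_mul hc0, ← ENNReal.ofReal_mul (by positivity)] at hhx hhy
    rw [ENNReal.ofReal_mul (abs_nonneg _), ← hV, two_mul (2 * R * _),
      ENNReal.ofReal_add (by positivity) (by positivity)]
    refine le_trans ?_ (add_le_add hhx hhy)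
    rw [← lintegral_add_left (by have := hg.continuous; fun_prop), ← setLIntegral_const]
    apply lintegral_mono
    intro z
    show _ ≤ ‖g z - g x‖ₑ + ‖g z - g y‖ₑ
    rw [← ofReal_norm, ← ofReal_norm,
      ← ENNReal.ofReal_add (norm_nonneg _) (norm_nonneg _)]
    apply ENNReal.ofReal_le_ofReal
    have := abs_sub_le (g x) (g z) (g y)
    rw [abs_sub_comm (g x) (g z)] at this
    exact this
  have hc0 : 0 ≤ 1 / (1 - (k:ℝ) / p) := by rw [hcst]; positivity
  rw [ENNReal.ofReal_le_ofReal_iff (by positivity), hcst, sub_eq_add_neg 1 (1 / p), Real.rpow_add hV0,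
    Real.rpow_one] at key
  have hVp : V ^ (-(1 / p)) ≤ (k : ℝ) ^ (1 / (2 * (1 + α))) * R ^ (-((k:ℝ) / p)) := by
    calc V ^ (-(1 / p)) ≤ ((R / √k) ^ k) ^ (-(1 / p)) :=
          Real.rpow_le_rpow_of_nonpos (by positivity) hVlow (by
            have : 0 < 1 / p := by positivity
            linarith)
      _ = _ := by
        rw [← Real.rpow_natCast, ← Real.rpow_mul (by positivity), Real.div_rpow hR.le hs.le,
          Real.sqrt_eq_rpow, ← Real.rpow_mul hk0.le, div_eq_mul_inv, ← Real.rpow_neg hk0.le,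
          mul_comm]
        have e : (k:ℝ) * -(1 / p) = -(k / p) := by ring
        rw [e]
        congr 2
        rw [hkps]; field_simp
  have key2 : |g x - g y| ≤ 4 * R * ((1 + α) / α) * I ^ (1 / p) * V ^ (-(1 / p)) := by
    apply le_of_mul_le_mul_right _ hV0
    linarith [key]
  refine key2.trans ?_
  calc _ ≤ 4 * R * ((1 + α) / α) * I ^ (1 / p) *
        ((k : ℝ) ^ (1 / (2 * (1 + α))) * R ^ (-((k:ℝ) / p))) := by
        gcongr
    _ = _ := by
        rw [sub_eq_add_neg 1, Real.rpow_add hR, Real.rpow_one]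
        ring
end
end

section
/- Let k ≥ 1 be an integer, 0 < α ≤ 1, and p = (1 + α)k. Let f : B(0,1) → ℝ be locally Lipschitz, where B(0,1) ⊂ ℝ^k is the closed unit ball. Let x ∈ ℝ^k be a unit vector and let Z be a random point distributed uniformly in the (k−1)-dimensional ball B(0,1) ∩ x^⊥ = {v ∈ ℝ^k : |v| ≤ 1, v · x = 0}. Then 𝔼 |f(x) − f(Z)| ≤ 2 · ((1+α)/α) · k^{1/(2(1+α))} · (∫_{B(0,1)} |∇f|^p)^{1/p}. -/
open Real MeasureTheory Metric
open scoped RealInnerProductSpace ENNReal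

noncomputable section

/-- Geometry: an isometric parametrisation of the orthogonal complement. -/
lemma exists_param (n : ℕ) (x : EuclideanSpace ℝ (Fin (n+1))) (hx : ‖x‖ = 1) :
    ∃ L : EuclideanSpace ℝ (Fin n) →ₗᵢ[ℝ] EuclideanSpace ℝ (Fin (n+1)),
      (∀ v, v ∈ Set.range L ↔ ⟪v, x⟫ = 0) ∧
      MeasurePreserving (fun q : ℝ × EuclideanSpace ℝ (Fin n) => q.1 • x + L q.2) := by
  have hx0 : x ≠ 0 := by
    intro h; simp [h] at hx
  have : Fact (Module.finrank ℝ (EuclideanSpace ℝ (Fin (n+1))) = n + 1) := ⟨by simp⟩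
  let e : EuclideanSpace ℝ (Fin n) ≃ₗᵢ[ℝ] (ℝ ∙ x)ᗮ :=
    (OrthonormalBasis.fromOrthogonalSpanSingleton (𝕜 := ℝ) n hx0).repr.symm
  let L : EuclideanSpace ℝ (Fin n) →ₗᵢ[ℝ] EuclideanSpace ℝ (Fin (n+1)) :=
    (ℝ ∙ x)ᗮ.subtypeₗᵢ.comp e.toLinearIsometry
  have hL : ∀ w, ⟪L w, x⟫ = 0 := fun w => by
    have := (e w).2
    rw [Submodule.mem_orthogonal_singleton_iff_inner_left] at this
    exact this
  refine ⟨L, fun v => ⟨?_, fun h => ?_⟩, ?_⟩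
  · rintro ⟨w, rfl⟩
    exact hL w
  · have hv : v ∈ (ℝ ∙ x)ᗮ := by
      rw [Submodule.mem_orthogonal_singleton_iff_inner_left]; exact h
    refine ⟨e.symm ⟨v, hv⟩, ?_⟩
    simp [L]
  · let P0 : WithLp 2 (ℝ × EuclideanSpace ℝ (Fin n)) →ₗ[ℝ] EuclideanSpace ℝ (Fin (n+1)) :=
      { toFun := fun q => q.fst • x + L q.snd
        map_add' := fun a b => by
          simp only [WithLp.add_fst, WithLp.add_snd, map_add, add_smul]; abel
        map_smul' := fun c a => by
          simp only [WithLp.smul_fst, WithLp.smul_snd, map_smul, smul_add, smul_eq_mul, mul_smul,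
            RingHom.id_apply] }
    let P1 : WithLp 2 (ℝ × EuclideanSpace ℝ (Fin n)) →ₗᵢ[ℝ] EuclideanSpace ℝ (Fin (n+1)) :=
      { P0 with
        norm_map' := fun q => by
          have h1 : ‖q.fst • x + L q.snd‖ ^ 2 = ‖q‖ ^ 2 := by
            rw [WithLp.prod_norm_sq_eq_of_L2, norm_add_sq_real, inner_smul_left,
              real_inner_comm, hL, norm_smul, hx, L.norm_map]
            simp
          exact (sq_eq_sq₀ (norm_nonneg _) (norm_nonneg _)).1 h1 }
    let P2 := P1.toLinearIsometryEquiv (by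
      rw [(WithLp.linearEquiv 2 ℝ (ℝ × EuclideanSpace ℝ (Fin n))).finrank_eq]
      simp [add_comm])
    have := P2.measurePreserving.comp
      (WithLp.volume_preserving_toLp ℝ (EuclideanSpace ℝ (Fin n)))
    exact this

lemma ball_volume (n : ℕ) : ENNReal.ofReal (((n+1 : ℝ) ^ (((n:ℝ)+1)/2))⁻¹) ≤
    volume (closedBall (0 : EuclideanSpace ℝ (Fin n)) 1) := by
  set r : ℝ := (√(n+1))⁻¹ with hr
  have hr0 : 0 < r := by positivity
  have h1 : volume (closedBall (0 : Fin n → ℝ) r) ≤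
      volume (closedBall (0 : EuclideanSpace ℝ (Fin n)) 1) := by
    rw [← (PiLp.volume_preserving_toLp (Fin n)).measure_preimage
      (measurableSet_closedBall.nullMeasurableSet)]
    apply measure_mono
    intro w hw
    simp only [Set.mem_preimage, mem_closedBall, dist_zero_right] at hw ⊢
    rw [← sq_le_one_iff₀ (norm_nonneg _), EuclideanSpace.norm_sq_eq]
    calc ∑ i, ‖w i‖ ^ 2 ≤ ∑ i : Fin n, r ^ 2 := by
          gcongr with i
          exact (norm_le_pi_norm w i).trans hw
      _ = n * (n+1:ℝ)⁻¹ := by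
          simp [hr, inv_pow, Real.sq_sqrt (by positivity : (0:ℝ) ≤ n+1)]
      _ ≤ 1 := by
          rw [← div_eq_mul_inv, div_le_one (by positivity)]; linarith
  refine le_trans ?_ h1
  rw [Real.volume_pi_closedBall _ hr0.le]
  apply ENNReal.ofReal_le_ofReal
  simp only [Fintype.card_fin]
  have h2 : r ^ n ≤ (2 * r) ^ n := by gcongr; linarith
  refine le_trans ?_ h2
  rw [hr, inv_pow, Real.sqrt_eq_rpow, ← Real.rpow_natCast, ← Real.rpow_mul (by positivity)]
  gcongr
  · simp
  · linarith

lemma cone_change (n : ℕ) {X : Type*} [NormedAddCommGroup X] [NormedSpace ℝ X]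
    [MeasureSpace X] [BorelSpace X] (x : X) (L : EuclideanSpace ℝ (Fin n) →ₗ[ℝ] X)
    (hP : MeasurePreserving (fun q : ℝ × EuclideanSpace ℝ (Fin n) => q.1 • x + L q.2))
    (H : X → ℝ≥0∞) (hH : Measurable H) :
    ∫⁻ q, H ((1 - q.1) • x + L (q.1 • q.2)) * ENNReal.ofReal q.1 ^ n
      ∂((volume.restrict (Set.Ioo (0:ℝ) 1)).prod (volume : Measure (EuclideanSpace ℝ (Fin n))))
    ≤ ∫⁻ y, H y := by
  have hHP : Measurable (fun q : ℝ × EuclideanSpace ℝ (Fin n) => H (q.1 • x + L q.2)) :=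
    hH.comp hP.measurable
  have hm : Measurable (fun q : ℝ × EuclideanSpace ℝ (Fin n) =>
      H ((1 - q.1) • x + L (q.1 • q.2)) * ENNReal.ofReal q.1 ^ n) := by
    apply Measurable.mul
    · exact hHP.comp (f := fun q : ℝ × EuclideanSpace ℝ (Fin n) => (1 - q.1, q.1 • q.2))
        (by fun_prop)
    · fun_prop
  rw [lintegral_prod _ hm.aemeasurable]
  have key : ∀ t ∈ Set.Ioo (0:ℝ) 1,
      ∫⁻ z, H ((1 - t) • x + L (t • z)) * ENNReal.ofReal t ^ n
        = ∫⁻ w, H ((1 - t) • x + L w) := by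
    intro t ht
    have hmt : Measurable (fun w => H ((1 - t) • x + L w)) :=
      hHP.comp (f := fun w => (1 - t, w)) (by fun_prop)
    have h1 := lintegral_map (μ := (volume : Measure (EuclideanSpace ℝ (Fin n)))) hmt
      (measurable_const_smul t)
    rw [Measure.map_addHaar_smul _ ht.1.ne', lintegral_smul_measure] at h1
    have hmt2 : Measurable (fun z => H ((1 - t) • x + L (t • z))) :=
      hmt.comp (measurable_const_smul t)
    rw [lintegral_mul_const _ hmt2, ← h1]
    have htn : 0 < t ^ n := pow_pos ht.1 n
    simp only [finrank_euclideanSpace, Fintype.card_fin, smul_eq_mul]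
    rw [abs_of_pos (by positivity), ← ENNReal.ofReal_pow ht.1.le, mul_right_comm,
      ← ENNReal.ofReal_mul (by positivity), inv_mul_cancel₀ htn.ne']
    simp
  rw [setLIntegral_congr_fun measurableSet_Ioo key]
  calc _ ≤ ∫⁻ t : ℝ, ∫⁻ w, H ((1 - t) • x + L w) := setLIntegral_le_lintegral _ _
    _ = ∫⁻ s : ℝ, ∫⁻ w, H (s • x + L w) :=
        lintegral_sub_left_eq_self (fun s : ℝ => ∫⁻ w, H (s • x + L w)) 1
    _ = ∫⁻ q : ℝ × EuclideanSpace ℝ (Fin n), H (q.1 • x + L q.2) := by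
        rw [Measure.volume_eq_prod, lintegral_prod _ hHP.aemeasurable]
    _ = _ := hP.lintegral_comp hH

lemma ae_diff_cone (n : ℕ) (g : EuclideanSpace ℝ (Fin (n+1)) → ℝ) (C : NNReal)
    (hg : LipschitzWith C g) (x : EuclideanSpace ℝ (Fin (n+1)))
    (L : EuclideanSpace ℝ (Fin n) →ₗᵢ[ℝ] EuclideanSpace ℝ (Fin (n+1)))
    (hP : MeasurePreserving (fun q : ℝ × EuclideanSpace ℝ (Fin n) => q.1 • x + L q.2)) :
    ∀ᵐ z : EuclideanSpace ℝ (Fin n), ∀ᵐ t ∂(volume.restrict (Set.Ioo (0:ℝ) 1)),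
      DifferentiableAt ℝ g ((1 - t) • x + L (t • z)) := by
  have hN : MeasurableSet {y | ¬ DifferentiableAt ℝ g y} :=
    (measurableSet_of_differentiableAt ℝ g).compl
  have h0 : volume {y | ¬ DifferentiableAt ℝ g y} = 0 := hg.ae_differentiableAt
  have hc : Measurable (fun q : ℝ × EuclideanSpace ℝ (Fin n) => (1 - q.1) • x + L (q.1 • q.2)) := by
    have := L.continuous.measurable
    fun_prop
  have h1 := cone_change n x L.toLinearMap hP
    ({y | ¬ DifferentiableAt ℝ g y}.indicator 1) (measurable_one.indicator hN)
  rw [lintegral_indicator_one hN, h0, nonpos_iff_eq_zero, lintegral_eq_zero_iff] at h1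
  · have h2 : ∀ᵐ q ∂((volume.restrict (Set.Ioo (0:ℝ) 1)).prod
        (volume : Measure (EuclideanSpace ℝ (Fin n)))),
        DifferentiableAt ℝ g ((1 - q.1) • x + L (q.1 • q.2)) := by
      have h3 : ∀ᵐ q ∂((volume.restrict (Set.Ioo (0:ℝ) 1)).prod
        (volume : Measure (EuclideanSpace ℝ (Fin n)))), q.1 ∈ Set.Ioo (0:ℝ) 1 :=
        Measure.quasiMeasurePreserving_fst.ae (ae_restrict_mem measurableSet_Ioo)
      filter_upwards [h1, h3] with q hq ht
      by_contra hcon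
      have : ENNReal.ofReal q.1 ≠ 0 := by simpa using ht.1
      simp only [LinearIsometry.coe_toLinearMap, Pi.zero_apply, mul_eq_zero] at hq
      rcases hq with hq | hq
      · rw [Set.indicator_of_mem (by exact hcon)] at hq
        simp at hq
      · exact (pow_ne_zero n this) hq
    rw [← Measure.prod_swap] at h2
    exact Measure.ae_ae_of_ae_prod (ae_of_ae_map measurable_swap.aemeasurable h2)
  · refine Measurable.mul ((measurable_one.indicator hN).comp hc) (by fun_prop)

lemma seg_bound {X : Type*} [NormedAddCommGroup X] [NormedSpace ℝ X] [MeasurableSpace X]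
    (g : X → ℝ) (C : NNReal) (hg : LipschitzWith C g) (x z : X) (hx : ‖x‖ ≤ 1) (hz : ‖z‖ ≤ 1)
    (hd : ∀ᵐ t ∂(volume.restrict (Set.Ioo (0:ℝ) 1)), DifferentiableAt ℝ g ((1 - t) • x + t • z)) :
    ‖g x - g z‖ₑ ≤ ∫⁻ t in Set.Ioo (0:ℝ) 1, 2 * ‖fderiv ℝ g ((1 - t) • x + t • z)‖ₑ := by
  set φ : ℝ → ℝ := fun t => g ((1 - t) • x + t • z) with hφ
  have hlip : LipschitzWith (C * nndist x z) φ := by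
    have := hg.comp (lipschitzWith_lineMap (𝕜 := ℝ) x z)
    have h2 : φ = g ∘ (AffineMap.lineMap x z : ℝ → X) := by
      ext t
      simp [hφ, AffineMap.lineMap_apply_module]
    rw [h2]; exact this
  have hF := (hlip.lipschitzOnWith (s := Set.uIcc 0 1)).absolutelyContinuousOnInterval.integral_deriv_eq_sub
  have h01 : φ 1 - φ 0 = g z - g x := by simp [hφ]
  rw [← enorm_neg, neg_sub, ← h01, ← hF, intervalIntegral.integral_of_le zero_le_one,
    ← integral_Ioc_eq_integral_Ioo.symm]
  refine (enorm_integral_le_lintegral_enorm _).trans ?_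
  apply lintegral_mono_ae
  filter_upwards [hd] with t ht
  have hc : HasDerivAt (fun t : ℝ => (1 - t) • x + t • z) (z - x) t := by
    have h1 := ((hasDerivAt_id t).const_sub 1).smul_const x
    have h2 := (hasDerivAt_id t).smul_const z
    have h3 := h1.add h2
    have h4 : (-1 : ℝ) • x + (1 : ℝ) • z = z - x := by
      rw [neg_one_smul, one_smul]; abel
    rw [h4] at h3
    exact h3
  have hder : deriv φ t = fderiv ℝ g ((1 - t) • x + t • z) (z - x) :=
    (ht.hasFDerivAt.comp_hasDerivAt t hc).deriv
  rw [hder, mul_comm]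
  refine (ContinuousLinearMap.le_opENorm _ _).trans ?_
  gcongr
  rw [← ofReal_norm, show (2:ℝ≥0∞) = ENNReal.ofReal 2 by simp]
  apply ENNReal.ofReal_le_ofReal
  linarith [norm_sub_le z x]

lemma t_integral (a : ℝ) (ha : -1 < a) :
    ∫⁻ t in Set.Ioo (0:ℝ) 1, ENNReal.ofReal t ^ a = ENNReal.ofReal (1 / (a + 1)) := by
  have h1 : ∫⁻ t in Set.Ioo (0:ℝ) 1, ENNReal.ofReal t ^ a
      = ∫⁻ t in Set.Ioo (0:ℝ) 1, ENNReal.ofReal (t ^ a) :=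
    setLIntegral_congr_fun measurableSet_Ioo fun t ht => ENNReal.ofReal_rpow_of_pos ht.1
  have hi : IntegrableOn (fun t : ℝ => t ^ a) (Set.Ioo 0 1) := by
    have := (intervalIntegral.intervalIntegrable_rpow' (a := 0) (b := 1) ha)
    rw [intervalIntegrable_iff_integrableOn_Ioo_of_le zero_le_one] at this
    exact this
  rw [h1, ← ofReal_integral_eq_lintegral_ofReal hi]
  · rw [← integral_Ioc_eq_integral_Ioo, ← intervalIntegral.integral_of_le zero_le_one,
      integral_rpow (Or.inl ha)]
    rw [Real.one_rpow, Real.zero_rpow (by linarith), sub_zero]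
  · filter_upwards [ae_restrict_mem measurableSet_Ioo] with t ht
    exact Real.rpow_nonneg ht.1.le _

lemma core (n : ℕ) (α p q : ℝ) (hα : 0 < α) (hp : p = (1 + α) * (n + 1))
    (hpq : p.HolderConjugate q)
    (g : EuclideanSpace ℝ (Fin (n+1)) → ℝ) (C : NNReal)
    (hg : LipschitzWith C g) (x : EuclideanSpace ℝ (Fin (n+1))) (hx : ‖x‖ = 1)
    (L : EuclideanSpace ℝ (Fin n) →ₗᵢ[ℝ] EuclideanSpace ℝ (Fin (n+1)))
    (hP : MeasurePreserving (fun q : ℝ × EuclideanSpace ℝ (Fin n) => q.1 • x + L q.2)) :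
    ∫⁻ z in closedBall (0 : EuclideanSpace ℝ (Fin n)) 1, ‖g x - g (L z)‖ₑ ≤
      2 * ((∫⁻ y in closedBall (0 : EuclideanSpace ℝ (Fin (n+1))) 1, ‖fderiv ℝ g y‖ₑ ^ p) ^ (1/p)
       * (ENNReal.ofReal ((1 + α) / α) * volume (closedBall (0 : EuclideanSpace ℝ (Fin n)) 1))
          ^ (1/q)) := by
  set D := closedBall (0 : EuclideanSpace ℝ (Fin n)) 1 with hD
  set B := closedBall (0 : EuclideanSpace ℝ (Fin (n+1))) 1 with hB
  set c : ℝ × EuclideanSpace ℝ (Fin n) → EuclideanSpace ℝ (Fin (n+1)) :=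
    fun q => (1 - q.1) • x + L (q.1 • q.2) with hc_def
  have hc : Measurable c := by
    have := L.continuous.measurable
    simp only [hc_def]
    fun_prop
  set G : EuclideanSpace ℝ (Fin (n+1)) → ℝ≥0∞ := fun y => ‖fderiv ℝ g y‖ₑ with hG_def
  have hG : Measurable G := (measurable_fderiv ℝ g).enorm
  have hDm : MeasurableSet D := measurableSet_closedBall
  have hBm : MeasurableSet B := measurableSet_closedBall
  have hp0 : 0 < p := hpq.pos
  have hp1 : 1 < p := hpq.lt
  set ν := (volume.restrict (Set.Ioo (0:ℝ) 1)).prod (volume.restrict D) with hν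
  have hνr : ν = ((volume.restrict (Set.Ioo (0:ℝ) 1)).prod
        (volume : Measure (EuclideanSpace ℝ (Fin n)))).restrict (Set.univ ×ˢ D) := by
    rw [← Measure.prod_restrict, Measure.restrict_univ]
  have hmem : ∀ᵐ q ∂ν, q.1 ∈ Set.Ioo (0:ℝ) 1 ∧ q.2 ∈ D := by
    have h1 : ∀ᵐ q ∂ν, q.1 ∈ Set.Ioo (0:ℝ) 1 :=
      Measure.quasiMeasurePreserving_fst.ae (ae_restrict_mem measurableSet_Ioo)
    have h2 : ∀ᵐ q ∂ν, q.2 ∈ D :=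
      Measure.quasiMeasurePreserving_snd.ae (ae_restrict_mem hDm)
    filter_upwards [h1, h2] with q a b using ⟨a, b⟩
  -- step 1
  have s1 : ∫⁻ z in D, ‖g x - g (L z)‖ₑ ≤ ∫⁻ z in D, ∫⁻ t in Set.Ioo (0:ℝ) 1, 2 * G (c (t, z)) := by
    apply lintegral_mono_ae
    filter_upwards [ae_restrict_of_ae (ae_diff_cone n g C hg x L hP), ae_restrict_mem hDm]
      with z hz hzD
    have hzn : ‖L z‖ ≤ 1 := by simpa [hD] using hzD
    have := seg_bound g C hg x (L z) hx.le hzn (by simpa using hz)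
    simpa [hG_def, hc_def] using this
  have s2 : ∫⁻ z in D, ∫⁻ t in Set.Ioo (0:ℝ) 1, 2 * G (c (t, z)) = ∫⁻ q, 2 * G (c q) ∂ν := by
    rw [hν, lintegral_prod_symm]
    exact ((hG.comp hc).const_mul 2).aemeasurable
  have s2' : ∫⁻ q, 2 * G (c q) ∂ν = 2 * ∫⁻ q, G (c q) ∂ν := lintegral_const_mul _ (hG.comp hc)
  rw [s2, s2'] at s1
  refine s1.trans ?_
  gcongr
  set F1 : ℝ × EuclideanSpace ℝ (Fin n) → ℝ≥0∞ :=
    fun q => G (c q) * ENNReal.ofReal q.1 ^ ((n:ℝ)/p) with hF1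
  set F2 : ℝ × EuclideanSpace ℝ (Fin n) → ℝ≥0∞ :=
    fun q => ENNReal.ofReal q.1 ^ (-((n:ℝ)/p)) with hF2
  have hF1m : Measurable F1 := (hG.comp hc).mul (by fun_prop)
  have hF2m : Measurable F2 := by simp only [hF2]; fun_prop
  have s3 : ∫⁻ q, G (c q) ∂ν = ∫⁻ q, (F1 * F2) q ∂ν := by
    apply lintegral_congr_ae
    filter_upwards [hmem] with q hq
    have h0 : ENNReal.ofReal q.1 ≠ 0 := by simpa using hq.1.1
    simp only [Pi.mul_apply, hF1, hF2]
    rw [mul_assoc, ← ENNReal.rpow_add _ _ h0 ENNReal.ofReal_ne_top]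
    simp
  rw [s3]
  refine (ENNReal.lintegral_mul_le_Lp_mul_Lq ν hpq hF1m.aemeasurable hF2m.aemeasurable).trans ?_
  have hq0 : 0 < q := hpq.symm.pos
  gcongr
  · -- first factor
    have e1 : ∫⁻ r, F1 r ^ p ∂ν ≤ ∫⁻ r, B.indicator (fun y => G y ^ p) (c r)
        * ENNReal.ofReal r.1 ^ n ∂ν := by
      apply lintegral_mono_ae
      filter_upwards [hmem] with r hr
      have hcB : c r ∈ B := by
        have hr2 : ‖r.2‖ ≤ 1 := by simpa [hD] using hr.2
        simp only [hB, hc_def, mem_closedBall, dist_zero_right]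
        refine (norm_add_le _ _).trans ?_
        rw [norm_smul, hx, L.norm_map, norm_smul, Real.norm_of_nonneg (by linarith [hr.1.2]),
          Real.norm_of_nonneg hr.1.1.le]
        nlinarith [hr.1.1]
      rw [Set.indicator_of_mem hcB]
      simp only [hF1]
      rw [ENNReal.mul_rpow_of_nonneg _ _ hp0.le, ← ENNReal.rpow_mul, div_mul_cancel₀ _ hp0.ne',
        ENNReal.rpow_natCast]
    refine e1.trans ?_
    rw [hνr]
    refine (setLIntegral_le_lintegral _ _).trans ?_
    refine (cone_change n x L.toLinearMap hP (B.indicator (fun y => G y ^ p))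
      ((hG.pow_const p).indicator hBm)).trans ?_
    rw [lintegral_indicator hBm]
  · -- second factor
    have hqp : q = p / (p - 1) := hpq.conjugate_eq
    set a : ℝ := -((n:ℝ)/p) * q with ha
    have ha' : a = - (n / (p - 1)) := by
      rw [ha, hqp]; field_simp
    have hpn : p - 1 = n + α * (n+1) := by rw [hp]; ring
    have hn0 : (0:ℝ) ≤ n := Nat.cast_nonneg n
    have hpos : 0 < (n:ℝ) + α * (n+1) := by positivity
    have ha1 : a + 1 = α * (n+1) / (n + α * (n+1)) := by
      rw [ha', hpn]; field_simp; ring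
    have ham : -1 < a := by
      have : 0 < a + 1 := by rw [ha1]; positivity
      linarith
    have e1 : ∫⁻ r, F2 r ^ q ∂ν = ∫⁻ r, ENNReal.ofReal r.1 ^ a ∂ν := by
      simp only [hF2, ← ENNReal.rpow_mul, ha]
    rw [e1, hν, lintegral_prod _ (by fun_prop)]
    simp only [lintegral_const, Measure.restrict_apply_univ]
    rw [lintegral_mul_const _ (by fun_prop), t_integral a ham]
    refine mul_le_mul' (ENNReal.ofReal_le_ofReal ?_) le_rfl
    rw [ha1, one_div_div, div_le_div_iff₀ (by positivity) hα]
    nlinarith [mul_nonneg hn0 hα.le]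

lemma final_ineq (A V I K p q : ℝ) (hA : 1 ≤ A) (hV : 0 < V) (hI : 0 ≤ I) (hK : 0 < K)
    (hpq : p.HolderConjugate q) (hVK : (K ^ p)⁻¹ ≤ V) :
    V⁻¹ * (2 * (I ^ (1/p) * (A * V) ^ (1/q))) ≤ 2 * A * K * I ^ (1/p) := by
  have hq := hpq.symm.pos
  have hp := hpq.pos
  have h1 : A ^ (1/q) ≤ A := by
    conv_rhs => rw [← Real.rpow_one A]
    apply Real.rpow_le_rpow_of_exponent_le hA
    rw [div_le_one hq]; exact hpq.symm.lt.le
  have h2 : V⁻¹ * V ^ (1/q) = (V⁻¹) ^ (1/p) := by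
    rw [Real.inv_rpow hV.le, ← Real.rpow_neg hV.le, ← Real.rpow_neg_one V, ← Real.rpow_add hV]
    congr 1
    have := hpq.inv_add_inv_eq_one
    rw [one_div, one_div]; linarith
  have h3 : (V⁻¹) ^ (1/p) ≤ K := by
    have : V⁻¹ ≤ K ^ p := by
      rw [inv_le_comm₀ hV (by positivity)]; exact hVK
    calc (V⁻¹) ^ (1/p) ≤ (K ^ p) ^ (1/p) := by gcongr
      _ = K := by rw [← Real.rpow_mul hK.le, mul_one_div_cancel hp.ne', Real.rpow_one]
  rw [Real.mul_rpow (by linarith) hV.le]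
  calc V⁻¹ * (2 * (I ^ (1/p) * (A ^ (1/q) * V ^ (1/q))))
      = 2 * A ^ (1/q) * (V⁻¹ * V ^ (1/q)) * I ^ (1/p) := by ring
    _ ≤ 2 * A * K * I ^ (1/p) := by
      rw [h2]
      gcongr

lemma haus_avg (n : ℕ) {X : Type*} [NormedAddCommGroup X] [NormedSpace ℝ X]
    [MeasurableSpace X] [BorelSpace X] (L : EuclideanSpace ℝ (Fin n) →ₗᵢ[ℝ] X) (S : Set X)
    (hSm : MeasurableSet S) (hS : S ⊆ Set.range L)
    (hpre : L ⁻¹' S = closedBall 0 1) (φ : X → ℝ) :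
    ∫ z, φ z ∂((μH[(n : ℝ)] S)⁻¹ • (μH[(n : ℝ)]).restrict S) =
      (volume (closedBall (0 : EuclideanSpace ℝ (Fin n)) 1)).toReal⁻¹ *
        ∫ z in closedBall (0 : EuclideanSpace ℝ (Fin n)) 1, φ (L z) := by
  have hLm : Measurable L := L.continuous.measurable
  have hemb : MeasurableEmbedding L := L.isometry.isClosedEmbedding.measurableEmbedding
  have : (μH[(n:ℝ)] : Measure (EuclideanSpace ℝ (Fin n))).IsAddHaarMeasure := by
    simpa using isAddHaarMeasure_hausdorffMeasure (E := EuclideanSpace ℝ (Fin n))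
  obtain ⟨c, hc0, hct, hc⟩ : ∃ c : ℝ≥0∞, c ≠ 0 ∧ c ≠ ∞ ∧
      (μH[(n:ℝ)] : Measure (EuclideanSpace ℝ (Fin n))) = c • volume :=
    ⟨_, by simpa using (Measure.addHaarScalarFactor_pos_of_isAddHaarMeasure _ _).ne',
      ENNReal.coe_ne_top, Measure.isAddLeftInvariant_eq_smul _ _⟩
  have h1 : (μH[(n : ℝ)]).restrict S =
      c • Measure.map L (volume.restrict (closedBall (0 : EuclideanSpace ℝ (Fin n)) 1)) := by
    rw [← Measure.restrict_restrict_of_subset hS,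
      ← L.isometry.map_hausdorffMeasure (Or.inl (Nat.cast_nonneg n)),
      Measure.restrict_map hLm hSm, hpre, hc, Measure.restrict_smul, Measure.map_smul]
  have h2 : μH[(n : ℝ)] S = c * volume (closedBall (0 : EuclideanSpace ℝ (Fin n)) 1) := by
    rw [← Measure.restrict_apply_univ, h1, Measure.smul_apply, Measure.map_apply hLm .univ]
    simp
  rw [h2, h1, integral_smul_measure, integral_smul_measure, hemb.integral_map, ENNReal.toReal_inv,
    ENNReal.toReal_mul, smul_eq_mul, smul_eq_mul, mul_inv, mul_comm _⁻¹ _⁻¹]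
  have : c.toReal ≠ 0 := (ENNReal.toReal_pos hc0 hct).ne'
  rw [mul_assoc, inv_mul_cancel_left₀ this]

/-- **The key estimate (2.10) in Lemma 2.5.** Let `k ≥ 1`, `0 < α ≤ 1`, `p = (1+α)k`.
Let `f` be locally Lipschitz on the closed unit ball `B(0,1) ⊆ ℝᵏ`, let `x` be a unit
vector, and let `Z` be uniform on the `(k-1)`-dimensional ball
`S = B(0,1) ∩ x^⊥ = {v : |v| ≤ 1, v·x = 0}` (i.e. distributed according to the
`(k-1)`-dimensional Hausdorff measure restricted to `S` and normalized; for `k = 1`,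
`S = {0}` and `Z = 0`). Then
`𝔼 |f(x) - f(Z)| ≤ 2 * ((1+α)/α) * k^(1/(2(1+α))) * (∫_{B(0,1)} |∇f|^p)^(1/p)`.
The a.e.-defined gradient of `f` is encoded by `fderiv ℝ f`. -/
theorem expected_difference_bound (k : ℕ) (hk : 1 ≤ k) (α : ℝ)
    (hα : 0 < α) (hα1 : α ≤ 1)
    (f : EuclideanSpace ℝ (Fin k) → ℝ)
    (hf : LocallyLipschitzOn (closedBall (0 : EuclideanSpace ℝ (Fin k)) 1) f)
    (x : EuclideanSpace ℝ (Fin k)) (hx : ‖x‖ = 1)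
    (S : Set (EuclideanSpace ℝ (Fin k)))
    (hS : S = {v : EuclideanSpace ℝ (Fin k) | ‖v‖ ≤ 1 ∧ ⟪v, x⟫ = 0}) :
    (∫ z, |f x - f z| ∂((μH[(k : ℝ) - 1] S)⁻¹ • (μH[(k : ℝ) - 1]).restrict S))
      ≤ 2 * ((1 + α) / α) * (k : ℝ) ^ (1 / (2 * (1 + α))) *
        (∫ z in closedBall (0 : EuclideanSpace ℝ (Fin k)) 1,
            ‖fderiv ℝ f z‖ ^ ((1 + α) * k)) ^ (1 / ((1 + α) * (k : ℝ))) := by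
  obtain ⟨n, rfl⟩ : ∃ n, k = n + 1 := ⟨k - 1, by omega⟩
  obtain ⟨L, hLr, hP⟩ := exists_param n x hx
  obtain ⟨C, hC⟩ := hf.exists_lipschitzOnWith_of_compact (isCompact_closedBall _ _)
  obtain ⟨g, hg, hfg⟩ := hC.extend_real
  have hdim : (((n + 1 : ℕ) : ℝ) - 1) = (n : ℝ) := by push_cast; ring
  rw [hdim]
  have hSc : IsClosed S := by
    rw [hS]
    exact (isClosed_le continuous_norm continuous_const).inter
      (isClosed_eq (by fun_prop) continuous_const)
  have hSr : S ⊆ Set.range L := by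
    rw [hS]; intro v hv; exact (hLr v).2 hv.2
  have hpre : L ⁻¹' S = closedBall 0 1 := by
    ext w
    have := (hLr (L w)).1 ⟨w, rfl⟩
    simp [hS, this]
  rw [haus_avg n L S hSc.measurableSet hSr hpre]
  set D := closedBall (0 : EuclideanSpace ℝ (Fin n)) 1 with hD
  set B := closedBall (0 : EuclideanSpace ℝ (Fin (n+1))) 1 with hB
  set p : ℝ := (1 + α) * ((n + 1 : ℕ) : ℝ) with hp
  have hn0 : (0:ℝ) ≤ n := Nat.cast_nonneg n
  have hp' : p = (1 + α) * (n + 1) := by rw [hp]; push_cast; ring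
  have hp1 : 1 < p := by rw [hp']; nlinarith
  have hpq := Real.HolderConjugate.conjExponent hp1
  set q := p.conjExponent
  have hcore := core n α p q hα hp' hpq g C hg x hx L hP
  set I := ∫⁻ y in B, ‖fderiv ℝ g y‖ₑ ^ p with hI
  have hIfin : I ≠ ∞ := by
    have : I ≤ ∫⁻ y in B, (C : ℝ≥0∞) ^ p := by
      apply lintegral_mono
      intro y
      have hy : ‖fderiv ℝ g y‖₊ ≤ C := norm_fderiv_le_of_lipschitz ℝ hg
      have hy2 : ‖fderiv ℝ g y‖ₑ ≤ (C : ℝ≥0∞) := by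
        rw [enorm_eq_nnnorm]; exact_mod_cast hy
      exact ENNReal.rpow_le_rpow hy2 (by linarith)
    refine ne_top_of_le_ne_top ?_ this
    rw [setLIntegral_const]
    exact ENNReal.mul_ne_top (ENNReal.rpow_ne_top_of_nonneg (by linarith) ENNReal.coe_ne_top)
      measure_closedBall_lt_top.ne
  have hVfin : volume D ≠ ∞ := measure_closedBall_lt_top.ne
  have hVpos : 0 < (volume D).toReal :=
    ENNReal.toReal_pos (measure_closedBall_pos _ _ one_pos).ne' hVfin
  have hxB : x ∈ B := by simp [hB, hx]
  have hleft : ∫ z in D, |f x - f (L z)| = (∫⁻ z in D, ‖g x - g (L z)‖ₑ).toReal := by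
    rw [← integral_norm_eq_lintegral_enorm]
    · apply setIntegral_congr_fun measurableSet_closedBall
      intro z hz
      have hz' : L z ∈ B := by simpa [hB, hD] using hz
      simp only [hfg hxB, hfg hz', Real.norm_eq_abs]
    · exact (continuous_const.sub (hg.continuous.comp L.continuous)).aestronglyMeasurable
  have hright : ∫ z in B, ‖fderiv ℝ f z‖ ^ p = I.toReal := by
    have hm : Measurable (fun y => ‖fderiv ℝ g y‖ₑ ^ p) :=
      (measurable_fderiv ℝ g).enorm.pow_const p
    rw [hI, ← integral_toReal hm.aemeasurable]
    · apply integral_congr_ae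
      have hsph : ∀ᵐ y ∂(volume.restrict B), y ∉ sphere (0 : EuclideanSpace ℝ (Fin (n+1))) 1 :=
        ae_restrict_of_ae (measure_eq_zero_iff_ae_notMem.1
          (Measure.addHaar_sphere_of_ne_zero volume 0 one_ne_zero))
      filter_upwards [hsph, ae_restrict_mem measurableSet_closedBall] with y hy1 hy2
      have hy : y ∈ ball (0 : EuclideanSpace ℝ (Fin (n+1))) 1 := by
        rw [mem_ball]
        exact lt_of_le_of_ne hy2 hy1
      have : f =ᶠ[nhds y] g :=
        Filter.eventuallyEq_of_mem (isOpen_ball.mem_nhds hy) (hfg.mono ball_subset_closedBall)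
      simp only [this.fderiv_eq]
      rw [← ENNReal.toReal_rpow, toReal_enorm]
    · exact Filter.Eventually.of_forall fun y =>
        (ENNReal.rpow_lt_top_of_nonneg (by linarith) enorm_ne_top)
  rw [hleft, hright]
  have hA : 1 ≤ (1 + α) / α := by rw [le_div_iff₀ hα]; linarith
  have hreal : (∫⁻ z in D, ‖g x - g (L z)‖ₑ).toReal ≤
      2 * (I.toReal ^ (1/p) * ((1 + α) / α * (volume D).toReal) ^ (1/q)) := by
    have h := ENNReal.toReal_mono ?_ hcore
    · refine h.trans_eq ?_
      rw [ENNReal.toReal_mul, ENNReal.toReal_mul, ← ENNReal.toReal_rpow, ← ENNReal.toReal_rpow,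
        ENNReal.toReal_mul, ENNReal.toReal_ofReal (by linarith)]
      rfl
    · have hq := hpq.symm.pos
      have h1 : 0 ≤ 1 / p := by positivity
      have h2 : 0 ≤ 1 / q := by positivity
      refine ENNReal.mul_ne_top (by simp) (ENNReal.mul_ne_top
        (ENNReal.rpow_ne_top_of_nonneg h1 hIfin)
        (ENNReal.rpow_ne_top_of_nonneg h2 (ENNReal.mul_ne_top ENNReal.ofReal_ne_top hVfin)))
  refine (mul_le_mul_of_nonneg_left hreal (inv_nonneg.2 hVpos.le)).trans ?_
  have hK : (0:ℝ) < ((n + 1 : ℕ) : ℝ) ^ (1 / (2 * (1 + α))) := by positivity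
  refine final_ineq _ _ _ _ p q hA hVpos ENNReal.toReal_nonneg hK hpq ?_
  have hb := ball_volume n
  rw [ENNReal.ofReal_le_iff_le_toReal hVfin] at hb
  refine le_trans (le_of_eq ?_) hb
  rw [← Real.rpow_mul (by positivity), hp']
  push_cast
  congr 2
  field_simp
end
end
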